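/- Every ali order contains no induced suborder isomorphic to O_obs1, no induced suborder isomorphic to O_obs2, and no induced suborder isomorphic to the antichain of size 3 (three pairwise incomparable elements). -/

import Mathlib

universe u

/-- The level of an element `x` of a partial order with well-founded `<`:
`Level(x) = sup { Level(y) + 1 : y < x }`, i.e. the rank of `x` with respect to `<`. -/
noncomputable def level (α : Type u) [PartialOrder α] [WellFoundedLT α] (x : α) : Ordinal.{u} :=
  IsWellFounded.rank (α := α) (· < ·) x

/-- Two elements of a partial order are incomparable. -/
def Incomp {α : Type u} [Preorder α] (a b : α) : Prop := ¬ a ≤ b ∧ ¬ b ≤ a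

/-- An order embedding `f : α ↪o β` is level-induced when
`Level(x) = Level(y) ↔ Level(f x) = Level(f y)` for all `x y`. -/
def LevelInduced {α β : Type u} [PartialOrder α] [WellFoundedLT α]
    [PartialOrder β] [WellFoundedLT β] (f : α ↪o β) : Prop :=
  ∀ x y : α, level α x = level α y ↔ level β (f x) = level β (f y)

/-- The gap between two elements: `max(Level x, Level y) - min(Level x, Level y)`
(ordinal subtraction). -/
noncomputable def gap (α : Type u) [PartialOrder α] [WellFoundedLT α] (x y : α) : Ordinal.{u} :=
  max (level α x) (level α y) - min (level α x) (level α y)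

/-- An order embedding `f : α ↪o β` is consecutive level-induced when it preserves gaps. -/
def ConsecutiveLevelInduced {α β : Type u} [PartialOrder α] [WellFoundedLT α]
    [PartialOrder β] [WellFoundedLT β] (f : α ↪o β) : Prop :=
  ∀ x y : α, gap α x y = gap β (f x) (f y)

/-- `α` is an ali order: whenever `α` order-embeds into a partial order `β` with
well-founded `<`, there is a level-induced order embedding of `α` into `β`. -/
def AliOrder (α : Type u) [PartialOrder α] [WellFoundedLT α] : Prop :=
  ∀ (β : Type u) [PartialOrder β] [WellFoundedLT β],
    Nonempty (α ↪o β) → ∃ f : α ↪o β, LevelInduced f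

/-- `α` is a nacli order: whenever there is a level-induced order embedding of `α` into a
partial order `β` with well-founded `<`, there is a consecutive level-induced order
embedding of `α` into `β`. -/
def NacliOrder (α : Type u) [PartialOrder α] [WellFoundedLT α] : Prop :=
  ∀ (β : Type u) [PartialOrder β] [WellFoundedLT β],
    (∃ f : α ↪o β, LevelInduced f) → ∃ g : α ↪o β, ConsecutiveLevelInduced g

/-- `α` contains an induced suborder isomorphic to `O_obs1`
(`a < b`, `c < d`, all other pairs incomparable). -/
def HasObs1 (α : Type u) [Preorder α] : Prop :=
  ∃ a b c d : α, a < b ∧ c < d ∧ Incomp a c ∧ Incomp a d ∧ Incomp b c ∧ Incomp b d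

/-- `α` contains an induced suborder isomorphic to `O_obs2`
(`a < b`, `a < c`, `b` and `c` incomparable). -/
def HasObs2 (α : Type u) [Preorder α] : Prop :=
  ∃ a b c : α, a < b ∧ a < c ∧ Incomp b c

/-- `α` contains an induced suborder isomorphic to `O_obs3`
(`b < a`, `c < a`, `b` and `c` incomparable). -/
def HasObs3 (α : Type u) [Preorder α] : Prop :=
  ∃ a b c : α, b < a ∧ c < a ∧ Incomp b c

/-- `α` contains an antichain of size 3. -/
def HasAntichain3 (α : Type u) [Preorder α] : Prop :=
  ∃ a b c : α, Incomp a b ∧ Incomp a c ∧ Incomp b c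

/-- `α` contains a chain `a < b < c` together with an element `d` incomparable to all three. -/
def HasChain3PlusPoint (α : Type u) [Preorder α] : Prop :=
  ∃ a b c d : α, a < b ∧ b < c ∧ Incomp a d ∧ Incomp b d ∧ Incomp c d

theorem level_eq_of_r {P γ : Type u} [PartialOrder P] [WellFoundedLT P] [LinearOrder γ]
    [WellFoundedLT γ] (r : P → γ) (hr : ∀ p q, p < q → r p < r q)
    (hs : ∀ p g, g < r p → ∃ q, q < p ∧ r q = g) (p : P) :
    level P p = level γ (r p) := by
  induction p using WellFoundedLT.induction with
  | ind p ih =>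
    unfold level at *
    apply le_antisymm
    · rw [IsWellFounded.rank_eq (· < ·) p]
      apply Ordinal.iSup_le
      rintro ⟨q, hq⟩
      rw [ih q hq]
      exact Order.succ_le_of_lt (IsWellFounded.rank_lt_of_rel (r := (· < ·)) (hr q p hq))
    · rw [IsWellFounded.rank_eq (· < ·) (r p)]
      apply Ordinal.iSup_le
      rintro ⟨g, hg⟩
      obtain ⟨q, hq, rfl⟩ := hs p g hg
      rw [← ih q hq]
      exact Order.succ_le_of_lt (IsWellFounded.rank_lt_of_rel (r := (· < ·)) hq)

theorem level_lt {P : Type u} [PartialOrder P] [WellFoundedLT P] {a b : P} (h : a < b) :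
    level P a < level P b := IsWellFounded.rank_lt_of_rel (r := (· < ·)) h

theorem level_inj_lin {γ : Type u} [LinearOrder γ] [WellFoundedLT γ] {g h : γ}
    (e : level γ g = level γ h) : g = h := by
  rcases lt_trichotomy g h with l | l | l
  · exact absurd e (level_lt l).ne
  · exact l
  · exact absurd e (level_lt l).ne'

theorem r_eq_of_level {P γ : Type u} [PartialOrder P] [WellFoundedLT P] [LinearOrder γ]
    [WellFoundedLT γ] (r : P → γ) (hr : ∀ p q, p < q → r p < r q)
    (hs : ∀ p g, g < r p → ∃ q, q < p ∧ r q = g) {p q : P} (h : level P p = level P q) :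
    r p = r q := by
  rw [level_eq_of_r r hr hs, level_eq_of_r r hr hs] at h
  exact level_inj_lin h

/-- Every level below the level of `x` is met strictly below `x`. -/
theorem exists_level {P : Type u} [PartialOrder P] [WellFoundedLT P] (x : P) :
    ∀ o < level P x, ∃ y, y < x ∧ level P y = o := by
  induction x using WellFoundedLT.induction with
  | ind x ih =>
    intro o ho
    by_contra hc
    push Not at hc
    have : level P x ≤ o := by
      unfold level at *
      rw [IsWellFounded.rank_eq (· < ·) x]
      apply Ordinal.iSup_le
      rintro ⟨y, hy⟩
      apply Order.succ_le_of_lt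
      by_contra hlt
      rcases (not_lt.1 hlt).lt_or_eq with h | h
      · obtain ⟨z, hz, hz'⟩ := ih y hy o h
        exact hc z (hz.trans hy) hz'
      · exact hc y hy h.symm
    exact absurd ho this.not_gt

section
variable {α γ : Type u} [PartialOrder α] [LinearOrder γ]

/-- Private chains below every element. -/
structure P1 (e : α → γ) where
  x : α
  g : γ
  le : g ≤ e x

theorem P1.ext' {e : α → γ} {p q : P1 e} (h : p.x = q.x) (h' : p.g = q.g) : p = q := by
  cases p; cases q; simp_all

/-- The order on private chains. -/
@[reducible] def P1.po (e : α → γ) (he : StrictMono e) : PartialOrder (P1 e) where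
  le p q := (p.x = q.x ∧ p.g ≤ q.g) ∨ (p.x ≤ q.x ∧ q.g = e q.x)
  le_refl p := Or.inl ⟨rfl, le_rfl⟩
  le_trans := by
    rintro ⟨x, g, hg⟩ ⟨y, h, hh⟩ ⟨z, k, hk⟩ h1 h2
    simp only at *
    rcases h1 with ⟨rfl, h1⟩ | ⟨h1, rfl⟩ <;> rcases h2 with ⟨rfl, h2⟩ | ⟨h2, rfl⟩
    · exact Or.inl ⟨rfl, h1.trans h2⟩
    · exact Or.inr ⟨h2, rfl⟩
    · exact Or.inr ⟨h1, le_antisymm hk h2⟩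
    · exact Or.inr ⟨h1.trans h2, rfl⟩
  le_antisymm := by
    rintro ⟨x, g, hg⟩ ⟨y, h, hh⟩ h1 h2
    simp only at *
    apply P1.ext' <;> simp only
    · rcases h1 with ⟨rfl, h1⟩ | ⟨h1, rfl⟩
      · rfl
      rcases h2 with ⟨rfl, h2⟩ | ⟨h2, rfl⟩
      · rfl
      exact le_antisymm h1 h2
    · rcases h1 with ⟨rfl, h1⟩ | ⟨h1, rfl⟩ <;> rcases h2 with ⟨-, h2⟩ | ⟨h2, rfl⟩
      · exact le_antisymm h1 h2
      · exact le_antisymm h1 hh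
      · exact le_antisymm (hg.trans (he.monotone (by assumption))) h2
      · rw [le_antisymm h1 h2]

/-- A common chain. -/
inductive P2 (e : α → γ)
  | el (x : α)
  | ch (g : γ)

/-- The relation. -/
def P2.rel (e : α → γ) : P2 e → P2 e → Prop
  | .el x, .el y => x ≤ y
  | .el _, .ch _ => False
  | .ch g, .el y => g < e y
  | .ch g, .ch h => g ≤ h

/-- The height. -/
def P2.r {e : α → γ} : P2 e → γ
  | .el x => e x
  | .ch g => g

/-- The order with a common chain. -/
@[reducible] def P2.po (e : α → γ) (he : StrictMono e) : PartialOrder (P2 e) where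
  le := P2.rel e
  le_refl p := by cases p <;> simp [P2.rel]
  le_trans := by
    rintro (x | g) (y | h) (z | k) h1 h2 <;> simp only [P2.rel] at *
    · exact h1.trans h2
    · exact h1.trans_le (he.monotone h2)
    · exact h1.trans_lt h2
    · exact h1.trans h2
  le_antisymm := by
    rintro (x | g) (y | h) h1 h2 <;> simp only [P2.rel] at *
    · rw [le_antisymm h1 h2]
    · rw [le_antisymm h1 h2]
end

theorem factA (α : Type u) [PartialOrder α] [WellFoundedLT α] (h : AliOrder α)
    {a b c : α} (hb : a < b) (hc : a < c) (hl : level α b = level α c) : b = c := by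
  let γ := WellOrderExtension α
  let e : α → γ := toWellOrderExtension
  have he : StrictMono e := toWellOrderExtension_strictMono
  have hei : Function.Injective e := toWellOrderExtension.injective
  let _ := P1.po e he
  have hle : ∀ p q : P1 e, p ≤ q ↔ (p.x = q.x ∧ p.g ≤ q.g) ∨ (p.x ≤ q.x ∧ q.g = e q.x) :=
    fun _ _ => Iff.rfl
  have hr : ∀ p q : P1 e, p < q → p.g < q.g := by
    intro p q hpq
    have hne := hpq.ne
    rcases (hle p q).1 hpq.le with ⟨h1, h2⟩ | ⟨h1, h2⟩
    · exact lt_of_le_of_ne h2 fun h => hne (P1.ext' h1 h)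
    · have h3 : p.g ≤ q.g := h2 ▸ p.le.trans (he.monotone h1)
      refine lt_of_le_of_ne h3 fun h => hne (P1.ext' ?_ h)
      apply hei
      exact le_antisymm (he.monotone h1) (by rw [← h2, ← h]; exact p.le)
  have : WellFoundedLT (P1 e) :=
    ⟨Subrelation.wf (fun {p q} hpq => hr p q hpq) (InvImage.wf P1.g (wellFounded_lt (α := γ)))⟩
  have hs : ∀ (p : P1 e) g, g < p.g → ∃ q, q < p ∧ P1.g q = g := by
    intro p g hg
    refine ⟨⟨p.x, g, hg.le.trans p.le⟩, lt_of_le_of_ne (Or.inl ⟨rfl, hg.le⟩) ?_, rfl⟩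
    intro hh
    exact hg.ne (congrArg P1.g hh)
  obtain ⟨f, hf⟩ := h (P1 e) ⟨OrderEmbedding.ofMapLEIff (fun x => ⟨x, e x, le_rfl⟩) (by
    intro x y
    rw [hle]
    simp only [and_true]
    constructor
    · rintro (h | h)
      · exact h.1.le
      · exact h
    · exact Or.inr)⟩
  have hg := r_eq_of_level P1.g hr hs ((hf b c).1 hl)
  have h1 := (hle _ _).1 (f.monotone hb.le)
  have h2 := (hle _ _).1 (f.monotone hc.le)
  apply f.injective
  apply P1.ext' _ hg
  have lb := (f b).le
  have lc := (f c).le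
  rcases h1 with ⟨h1, h1'⟩ | ⟨h1, h1'⟩ <;> rcases h2 with ⟨h2, h2'⟩ | ⟨h2, h2'⟩
  · exact h1.symm.trans h2
  · rw [h1] at h2
    exact hei (le_antisymm (he.monotone h2) (by rw [← h2', ← hg]; exact lb))
  · rw [h2] at h1
    exact hei (le_antisymm (by rw [← h1', hg]; exact lc) (he.monotone h1))
  · exact hei (by rw [← h1', ← h2', hg])

theorem factB (α : Type u) [PartialOrder α] [WellFoundedLT α] (h : AliOrder α) :
    (∀ a b c : α, level α a = level α b → level α a = level α c → a = b ∨ a = c ∨ b = c) ∧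
    (∀ a b c d : α, a < b → c < d → level α b = level α d → level α a = level α c → b ≠ d →
      a < d ∨ c < b) := by
  let γ := WellOrderExtension α
  let e : α → γ := toWellOrderExtension
  have he : StrictMono e := toWellOrderExtension_strictMono
  have hei : Function.Injective e := toWellOrderExtension.injective
  let _ := P2.po e he
  have hle : ∀ p q : P2 e, p ≤ q ↔ P2.rel e p q := fun _ _ => Iff.rfl
  have hr : ∀ p q : P2 e, p < q → p.r < q.r := by
    intro p q hpq
    have hne := hpq.ne
    have h1 := (hle p q).1 hpq.le
    rcases p with x | g <;> rcases q with y | k <;> simp only [P2.rel, P2.r] at *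
    · exact he (lt_of_le_of_ne h1 fun h => hne (by rw [h]))
    · exact h1
    · exact lt_of_le_of_ne h1 fun h => hne (by rw [h])
  have : WellFoundedLT (P2 e) :=
    ⟨Subrelation.wf (fun {p q} hpq => hr p q hpq) (InvImage.wf P2.r (wellFounded_lt (α := γ)))⟩
  have hs : ∀ (p : P2 e) g, g < p.r → ∃ q, q < p ∧ P2.r q = g := by
    intro p g hg
    refine ⟨.ch g, lt_of_le_of_ne ?_ ?_, rfl⟩
    · rw [hle]
      rcases p with x | k
      · exact hg
      · exact le_of_lt hg
    · rintro rfl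
      exact lt_irrefl _ hg
  obtain ⟨f, hf⟩ := h (P2 e) ⟨OrderEmbedding.ofMapLEIff (fun x => .el x) (fun x y => Iff.rfl)⟩
  have key : ∀ a b : α, level α a = level α b → (f a).r = (f b).r :=
    fun a b hab => r_eq_of_level P2.r hr hs ((hf a b).1 hab)
  constructor
  · intro a b c hab hac
    have h1 := key a b hab
    have h2 := key a c hac
    rw [← f.injective.eq_iff, ← f.injective.eq_iff (a := a) (b := c),
      ← f.injective.eq_iff (a := b) (b := c)]
    revert h1 h2
    rcases f a with x | x <;> rcases f b with y | y <;> rcases f c with z | z <;>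
      intro h1 h2 <;> simp only [P2.r] at h1 h2
    · exact Or.inl (by rw [hei h1])
    · exact Or.inl (by rw [hei h1])
    · exact Or.inr (Or.inl (by rw [hei h2]))
    · exact Or.inr (Or.inr (by rw [← h1, ← h2]))
    · exact Or.inr (Or.inr (by rw [hei (h1.symm.trans h2)]))
    · exact Or.inr (Or.inl (by rw [h2]))
    · exact Or.inl (by rw [h1])
    · exact Or.inl (by rw [h1])
  · intro a b c d hab hcd hbd hac hne
    have h1 := key b d hbd
    have hne' := f.injective.ne hne
    have l1 := f.lt_iff_lt.2 hab
    have l2 := f.lt_iff_lt.2 hcd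
    rw [← f.lt_iff_lt, ← f.lt_iff_lt (a := c)]
    have r1 := hr _ _ l1
    have r2 := hr _ _ l2
    have m1 := (hle _ _).1 l1.le
    have m2 := (hle _ _).1 l2.le
    have aux : ∀ (g : γ) (p : P2 e), g < p.r → P2.ch g < p := by
      intro g p hg
      refine lt_of_le_of_ne ?_ ?_
      · rw [hle]
        rcases p with x | k
        · exact hg
        · exact le_of_lt hg
      · rintro rfl
        exact lt_irrefl _ hg
    rcases hb : f b with x | x <;> rcases hd : f d with y | y
    · rw [hb, hd] at h1 hne'
      exact absurd (by rw [hei h1]) hne'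
    · right
      rw [hd] at m2
      rcases hc : f c with z | z
      · rw [hc] at m2; exact m2.elim
      · apply aux
        rw [hc] at r2
        rw [← hb, h1]
        exact r2
    · left
      rw [hb] at m1
      rcases ha : f a with z | z
      · rw [ha] at m1; exact m1.elim
      · apply aux
        rw [ha] at r1
        rw [← hd, ← h1]
        exact r1
    · rw [hb, hd] at h1 hne'
      simp only [P2.r] at h1
      exact absurd (by rw [h1]) hne'

/-- No ali order contains an induced copy of `O_obs1`, of `O_obs2`, or of the antichain of
size 3. -/
theorem stmt15 (α : Type u) [PartialOrder α] [WellFoundedLT α] (h : AliOrder α) :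
    ¬ HasObs1 α ∧ ¬ HasObs2 α ∧ ¬ HasAntichain3 α := by
  obtain ⟨hB, hC⟩ := factB α h
  have ge0 : ∀ b : α, 0 < level α b → ∃ a, a < b ∧ level α a = 0 :=
    fun b hb => exists_level b 0 hb
  have uniq : ∀ b d : α, 0 < level α b → level α b = level α d → b = d := by
    intro b d hb hbd
    by_contra hne
    obtain ⟨a, hab, ha⟩ := ge0 b hb
    obtain ⟨c, hcd, hc⟩ := ge0 d (hbd ▸ hb)
    rcases hC a b c d hab hcd hbd (ha.trans hc.symm) hne with h1 | h1
    · exact hne (factA α h hab h1 hbd)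
    · exact hne (factA α h h1 hcd hbd)
  have comp' : ∀ b d : α, 0 < level α b → level α b ≤ level α d → b ≤ d := by
    intro b d hb hbd
    rcases hbd.eq_or_lt with h1 | h1
    · exact (uniq b d hb h1).le
    · obtain ⟨y, hy, hy'⟩ := exists_level d _ h1
      rw [uniq b y hb hy'.symm]
      exact hy.le
  have comp : ∀ b d : α, 0 < level α b → 0 < level α d → ¬ Incomp b d := by
    intro b d hb hd hi
    rcases le_total (level α b) (level α d) with h1 | h1
    · exact hi.1 (comp' b d hb h1)
    · exact hi.2 (comp' d b hd h1)
  have pos : ∀ {a b : α}, a < b → 0 < level α b := fun hab => zero_le.trans_lt (level_lt hab)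
  refine ⟨?_, ?_, ?_⟩
  · rintro ⟨a, b, c, d, hab, hcd, -, -, -, hbd⟩
    exact comp b d (pos hab) (pos hcd) hbd
  · rintro ⟨a, b, c, hab, hac, hbc⟩
    exact comp b c (pos hab) (pos hac) hbc
  · rintro ⟨a, b, c, hab, hac, hbc⟩
    have sy : ∀ {x y : α}, Incomp x y → Incomp y x := fun h => ⟨h.2, h.1⟩
    have ne : ∀ {x y : α}, Incomp x y → x ≠ y := fun h e => h.1 e.le
    have one : ∀ x y z : α, level α x = 0 → level α y = 0 → 0 < level α z → Incomp x y →
        Incomp x z → Incomp y z → False := by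
      intro x y z hx hy hz hxy hxz hyz
      obtain ⟨w, hw, hw0⟩ := ge0 z hz
      rcases hB x y w (hx.trans hy.symm) (hx.trans hw0.symm) with e | e | e
      · exact ne hxy e
      · exact hxz.1 (e ▸ hw.le)
      · exact hyz.1 (e ▸ hw.le)
    rcases eq_zero_or_pos (level α a) with ha | ha <;>
      rcases eq_zero_or_pos (level α b) with hb | hb <;>
      rcases eq_zero_or_pos (level α c) with hc | hc
    · rcases hB a b c (ha.trans hb.symm) (ha.trans hc.symm) with e | e | e
      · exact ne hab e
      · exact ne hac e
      · exact ne hbc e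
    · exact one a b c ha hb hc hab hac hbc
    · exact one a c b ha hc hb hac hab (sy hbc)
    · exact comp b c hb hc hbc
    · exact one b c a hb hc ha hbc (sy hab) (sy hac)
    · exact comp a c ha hc hac
    · exact comp a b ha hb hab
    · exact comp a b ha hb hab
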